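/- Let k ≥ 2 divide n with n/k ≥ 6, let θ ∈ [k]^n be balanced (every community has size n/k), and let M : {0,1}^{n×n} → M_{n×k} be a symmetric (ε,δ)-node differentially private randomized mechanism. Let A ~ SBM(n, k, B, θ) for a symmetric matrix B with entries in (0,1], with A independent of the mechanism's internal randomness. Suppose P(𝓛̃(M(A), θ) ≤ ξ) ≥ 1 − η for some ξ ∈ (0,1/3) and η ≥ 0, and assume η + ξ + 2kδ > 0 and 1 − η − ξ − 2kδ > 0. Then ε ≥ (1/2)·log((1 − η − ξ − 2kδ)/(η + ξ + 2kδ)) + (1/2)·log(k−1). -/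

import Mathlib

open MeasureTheory Matrix

/-- The Bernoulli(p) measure on `ℝ`, giving mass `p` to `1` and `1−p` to `0`. -/
noncomputable def bern (p : ℝ) : Measure ℝ :=
  ENNReal.ofReal (1 - p) • Measure.dirac 0 + ENNReal.ofReal p • Measure.dirac 1

instance (p : ℝ) : IsFiniteMeasure (bern p) := by
  constructor
  simp only [bern, Measure.coe_add, Pi.add_apply, Measure.smul_apply, smul_eq_mul,
    measure_univ, mul_one]
  exact ENNReal.add_lt_top.2 ⟨ENNReal.ofReal_lt_top, ENNReal.ofReal_lt_top⟩

instance {m n α : Type*} [MeasurableSpace α] : MeasurableSpace (Matrix m n α) :=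
  (inferInstance : MeasurableSpace (m → n → α))

/-- The stochastic block model `SBM(n, k, B, θ)`: the law of the random symmetric `{0,1}`
matrix with zero diagonal whose entries `A_{ij}`, `i < j`, are independent
`Bernoulli(B_{θ_i θ_j})`, and `A_{ji} = A_{ij}`. -/
noncomputable def sbm (n k : ℕ) (B : Matrix (Fin k) (Fin k) ℝ) (θ : Fin n → Fin k) :
    Measure (Matrix (Fin n) (Fin n) ℝ) :=
  (Measure.pi fun p : {q : Fin n × Fin n // q.1 < q.2} => bern (B (θ p.1.1) (θ p.1.2))).map
    fun x => Matrix.of fun i j =>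
      if h : i < j then x ⟨(i, j), h⟩ else if h' : j < i then x ⟨(j, i), h'⟩ else 0

/-- The permutation matrix of `σ`: the matrix `L` with `L_{ij} = 1` iff `σ j = i`. -/
def permMat {n : ℕ} (σ : Equiv.Perm (Fin n)) : Matrix (Fin n) (Fin n) ℝ :=
  Matrix.of fun i j => if σ j = i then 1 else 0

/-- `A` is a `{0,1}`-matrix. -/
def Is01 {n : ℕ} (A : Matrix (Fin n) (Fin n) ℝ) : Prop :=
  ∀ i j, A i j = 0 ∨ A i j = 1

/-- `A` and `A'` are node-adjacent. -/
def NodeAdj {n : ℕ} (A A' : Matrix (Fin n) (Fin n) ℝ) : Prop :=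
  ∃ i0 : Fin n, ∀ j l, j ≠ i0 → l ≠ i0 → A j l = A' j l

/-- The mechanism `M` on `{0,1}` matrices is `(ε,δ)`-node differentially private. -/
def IsNodeDP {n k : ℕ} (M : Matrix (Fin n) (Fin n) ℝ → PMF (Fin n → Fin k))
    (ε δ : ℝ) : Prop :=
  ∀ A A', Is01 A → Is01 A' → NodeAdj A A' → ∀ S : Set (Fin n → Fin k),
    (M A).toOuterMeasure S
      ≤ ENNReal.ofReal (Real.exp ε) * (M A').toOuterMeasure S + ENNReal.ofReal δ

/-- The mechanism `M` is symmetric: `P(M(A) = θ̂) = P(M(L A Lᵀ) = L θ̂)` for every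
permutation matrix `L`. -/
def IsSymmetricMech {n k : ℕ}
    (M : Matrix (Fin n) (Fin n) ℝ → PMF (Fin n → Fin k)) : Prop :=
  ∀ (σ : Equiv.Perm (Fin n)) (A : Matrix (Fin n) (Fin n) ℝ) (θhat : Fin n → Fin k),
    Is01 A →
    M A θhat = M (permMat σ * A * (permMat σ)ᵀ) (fun i => θhat (σ⁻¹ i))

/-- The worst-case misclassification error `𝓛̃(θ̂, θ)`. -/
noncomputable def wcErr {n k : ℕ} (θhat θ : Fin n → Fin k) : ℝ :=
  ⨅ σ : Equiv.Perm (Fin k), ⨆ j : Fin k,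
    (2 / ((Finset.univ.filter fun i => θ i = j).card : ℝ)) *
      ((Finset.univ.filter fun i => θ i = j ∧ σ (θhat i) ≠ j).card : ℝ)

/-- `σ` aligns `θhat` with `θ` if in every community of `θ` less than a fraction `1/q` of the
nodes is misclassified by `σ ∘ θhat`. -/
def Aligned {V K : Type*} [Fintype V] [DecidableEq K] (q : ℕ) (θ : V → K)
    (σ : Equiv.Perm K) (θhat : V → K) : Prop :=
  ∀ c, q * (Finset.univ.filter fun i => θ i = c ∧ σ (θhat i) ≠ c).card
    < (Finset.univ.filter fun i => θ i = c).card

lemma Aligned.mono {V K : Type*} [Fintype V] [DecidableEq K] {q r : ℕ} (hqr : q ≤ r)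
    {θ θhat : V → K} {σ : Equiv.Perm K} (h : Aligned r θ σ θhat) : Aligned q θ σ θhat :=
  fun c => (Nat.mul_le_mul_right _ hqr).trans_lt (h c)

lemma Aligned.unique {V K : Type*} [Fintype V] [DecidableEq K] {θ θhat : V → K}
    {σ σ' : Equiv.Perm K} (h : Aligned 2 θ σ θhat) (h' : Aligned 2 θ σ' θhat) : σ = σ' := by
  classical
  suffices H : ∀ c, σ.symm c = σ'.symm c by
    rw [← Equiv.symm_symm σ, ← Equiv.symm_symm σ']
    exact congrArg _ (Equiv.ext H)
  intro c
  have hc := h c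
  have hc' := h' c
  by_contra hne
  have hsub : (Finset.univ.filter fun i => θ i = c) ⊆
      (Finset.univ.filter fun i => θ i = c ∧ σ (θhat i) ≠ c) ∪
      (Finset.univ.filter fun i => θ i = c ∧ σ' (θhat i) ≠ c) := by
    intro i hi
    simp only [Finset.mem_filter, Finset.mem_univ, true_and, Finset.mem_union] at hi ⊢
    by_contra hcon
    push Not at hcon
    apply hne
    rw [(Equiv.symm_apply_eq σ).2 (hcon.1 hi).symm, (Equiv.symm_apply_eq σ').2 (hcon.2 hi).symm]
  have := (Finset.card_le_card hsub).trans (Finset.card_union_le _ _)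
  omega

lemma Aligned.of_comp_swap {V K : Type*} [Fintype V] [DecidableEq V] [DecidableEq K]
    {θ θhat : V → K} {σ : Equiv.Perm K} (i j : V)
    (hsize : ∀ c, 6 ≤ (Finset.univ.filter fun i => θ i = c).card)
    (h : Aligned 6 θ σ fun v => θhat (Equiv.swap i j v)) : Aligned 2 θ σ θhat := by
  intro c
  have hc := h c
  have hs := hsize c
  have hsub : (Finset.univ.filter fun v => θ v = c ∧ σ (θhat v) ≠ c) ⊆
      (Finset.univ.filter fun v => θ v = c ∧ σ (θhat (Equiv.swap i j v)) ≠ c) ∪ {i, j} := by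
    intro v hv
    simp only [Finset.mem_filter, Finset.mem_univ, true_and, Finset.mem_union,
      Finset.mem_insert, Finset.mem_singleton] at hv ⊢
    by_cases hi : v = i
    · exact Or.inr (Or.inl hi)
    by_cases hj : v = j
    · exact Or.inr (Or.inr hj)
    rw [Equiv.swap_apply_of_ne_of_ne hi hj]
    exact Or.inl hv
  have h1 := (Finset.card_le_card hsub).trans (Finset.card_union_le _ _)
  have h2 := Finset.card_le_two (a := i) (b := j)
  beta_reduce at hc
  omega

lemma exists_aligned_of_wcErr_le {n k m : ℕ} (hm : 0 < m) {θ θhat : Fin n → Fin k}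
    (hbal : ∀ c : Fin k, (Finset.univ.filter fun i => θ i = c).card = m) {ξ : ℝ}
    (hξ : ξ < 1 / 3) (h : wcErr θhat θ ≤ ξ) :
    ∃ σ : Equiv.Perm (Fin k), Aligned 6 θ σ θhat ∧
      ((Finset.univ.filter fun i => σ (θhat i) ≠ θ i).card : ℝ) ≤ k * m * (ξ / 2) := by
  obtain ⟨σ, hσ⟩ := exists_eq_ciInf_of_finite (f := fun σ : Equiv.Perm (Fin k) =>
    ⨆ j : Fin k, (2 / ((Finset.univ.filter fun i => θ i = j).card : ℝ)) *
      ((Finset.univ.filter fun i => θ i = j ∧ σ (θhat i) ≠ j).card : ℝ))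
  have hm' : (0 : ℝ) < m := by exact_mod_cast hm
  have key : ∀ c, ((Finset.univ.filter fun i => θ i = c ∧ σ (θhat i) ≠ c).card : ℝ)
      ≤ m * (ξ / 2) := by
    intro c
    have h1 := (le_ciSup (f := fun j : Fin k =>
      (2 / ((Finset.univ.filter fun i => θ i = j).card : ℝ)) *
      ((Finset.univ.filter fun i => θ i = j ∧ σ (θhat i) ≠ j).card : ℝ))
      (Set.finite_range _).bddAbove c).trans (hσ.le.trans h)
    simp only [hbal] at h1
    rw [div_mul_eq_mul_div, div_le_iff₀ hm'] at h1
    linarith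
  refine ⟨σ, fun c => ?_, ?_⟩
  · rw [hbal]
    have := key c
    have h2 : (6 : ℝ) * ((Finset.univ.filter fun i => θ i = c ∧ σ (θhat i) ≠ c).card : ℝ) < m := by
      nlinarith
    exact_mod_cast h2
  · rw [Finset.card_eq_sum_card_fiberwise (f := θ) (t := Finset.univ) (by simp)]
    push_cast
    calc _ ≤ ∑ c : Fin k, (m : ℝ) * (ξ / 2) := by
          refine Finset.sum_le_sum fun c _ => (le_of_eq ?_).trans (key c)
          congr 2
          ext i
          simp only [Finset.mem_filter, Finset.mem_univ, true_and]
          constructor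
          · rintro ⟨h1, h2⟩
            exact ⟨h2, h2 ▸ h1⟩
          · rintro ⟨h1, h2⟩
            exact ⟨h1 ▸ h2, h1⟩
      _ = k * m * (ξ / 2) := by simp [mul_assoc]

/-- Estimates that align well with `θ` and label node `j` correctly. -/
def correctAt {V K : Type*} [Fintype V] [DecidableEq K] (θ : V → K) (j : V) : Set (V → K) :=
  {θhat | ∃ σ, Aligned 6 θ σ θhat ∧ σ (θhat j) = θ j}

/-- Estimates that align with `θ` and give node `i` the label `c`. -/
def labelledAt {V K : Type*} [Fintype V] [DecidableEq K] (θ : V → K) (i : V) (c : K) :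
    Set (V → K) :=
  {θhat | ∃ σ, Aligned 2 θ σ θhat ∧ σ (θhat i) = c}

/-- The pairs of nodes in different communities. -/
def crossPairs {V K : Type*} [Fintype V] [DecidableEq K] (θ : V → K) : Finset (V × V) :=
  Finset.univ.filter fun q => θ q.1 ≠ θ q.2

section Counting

open Classical

variable {V K : Type*} [Fintype V] [DecidableEq K] {m : ℕ} {θ θhat : V → K} {σ : Equiv.Perm K}

lemma card_cross_filter_snd (hbal : ∀ c, (Finset.univ.filter fun i => θ i = c).card = m)
    (p : V → Prop) [DecidablePred p] :
    ((crossPairs θ).filter fun q => p q.2).card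
      = (Fintype.card V - m) * (Finset.univ.filter p).card := by
  have h : (crossPairs θ).filter (fun q => p q.2)
      = (Finset.univ.filter p).biUnion
        fun j => (Finset.univ.filter fun i => ¬ θ i = θ j).image fun i => (i, j) := by
    ext ⟨a, b⟩
    simp only [crossPairs, Finset.mem_filter, Finset.mem_univ, true_and, Finset.mem_biUnion,
      Finset.mem_image, Prod.mk.injEq]
    constructor
    · rintro ⟨h1, h2⟩
      exact ⟨b, h2, a, h1, rfl, rfl⟩
    · rintro ⟨_, h2, _, h1, rfl, rfl⟩
      exact ⟨h1, h2⟩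
  rw [h, Finset.card_biUnion]
  · rw [Finset.sum_const_nat (m := Fintype.card V - m), mul_comm]
    intro j _
    rw [Finset.card_image_of_injective _ (Prod.mk_left_injective j), ← hbal (θ j),
      ← Finset.card_univ, ← Finset.card_filter_add_card_filter_not (s := Finset.univ)
        (fun i => θ i = θ j), Nat.add_sub_cancel_left]
  · intro a _ b _ hab
    rw [Function.onFun, Finset.disjoint_left]
    simp only [Finset.mem_image, not_exists, not_and]
    rintro _ ⟨_, _, rfl⟩ _ _ h
    exact hab (Prod.mk.inj h).2.symm

lemma card_filter_correctAt_ge (hbal : ∀ c, (Finset.univ.filter fun i => θ i = c).card = m)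
    (h : Aligned 6 θ σ θhat) :
    (Fintype.card V - m) * (Finset.univ.filter fun i => σ (θhat i) = θ i).card
      ≤ ((crossPairs θ).filter fun q => θhat ∈ correctAt θ q.2).card := by
  rw [card_cross_filter_snd hbal fun j => θhat ∈ correctAt θ j]
  refine Nat.mul_le_mul_left _ (Finset.card_le_card fun i hi => ?_)
  simp only [Finset.mem_filter, Finset.mem_univ, true_and] at hi ⊢
  exact ⟨σ, h, hi⟩

lemma card_filter_labelledAt_le (hbal : ∀ c, (Finset.univ.filter fun i => θ i = c).card = m)
    (h : Aligned 2 θ σ θhat) :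
    ((crossPairs θ).filter fun q => θhat ∈ labelledAt θ q.1 (θ q.2)).card
      ≤ m * (Finset.univ.filter fun i => σ (θhat i) ≠ θ i).card := by
  have hsub : (crossPairs θ).filter (fun q => θhat ∈ labelledAt θ q.1 (θ q.2))
      ⊆ (Finset.univ.filter fun i => σ (θhat i) ≠ θ i).biUnion
        fun i => (Finset.univ.filter fun j => θ j = σ (θhat i)).image fun j => (i, j) := by
    rintro ⟨a, b⟩ hab
    simp only [crossPairs, Finset.mem_filter, Finset.mem_univ, true_and, Finset.mem_biUnion,
      Finset.mem_image, Prod.mk.injEq] at hab ⊢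
    obtain ⟨hne, σ', hσ', hl⟩ := hab
    obtain rfl := h.unique hσ'
    exact ⟨a, fun h0 => hne (h0.symm.trans hl), b, hl.symm, rfl, rfl⟩
  refine (Finset.card_le_card hsub).trans (Finset.card_biUnion_le.trans ?_)
  rw [mul_comm]
  refine Finset.sum_le_card_nsmul _ _ _ fun i _ => ?_
  exact Finset.card_image_le.trans (hbal _).le

lemma card_filter_labelledAt_le_card
    (hbal : ∀ c, (Finset.univ.filter fun i => θ i = c).card = m) :
    ((crossPairs θ).filter fun q => θhat ∈ labelledAt θ q.1 (θ q.2)).card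
      ≤ m * Fintype.card V := by
  by_cases h : ∃ σ, Aligned 2 θ σ θhat
  · obtain ⟨σ, hσ⟩ := h
    exact (card_filter_labelledAt_le hbal hσ).trans
      (Nat.mul_le_mul_left _ (Finset.card_le_univ _))
  · rw [Finset.filter_false_of_mem]
    · simp
    · rintro q _ ⟨σ, hσ, _⟩
      exact h ⟨σ, hσ⟩

end Counting

section Averaging

open Classical

lemma averaged_inequality {n k m : ℕ} (hk : 0 < k) (hm : 0 < m) (hn : n = k * m)
    {θ : Fin n → Fin k} (hbal : ∀ c : Fin k, (Finset.univ.filter fun i => θ i = c).card = m)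
    {ξ η a b : ℝ} (hξ : ξ ∈ Set.Ioo (0 : ℝ) (1 / 3)) (hη : 0 ≤ η) (ha : 0 ≤ a)
    (p : (Fin n → Fin k) → ℝ) (hp : ∀ x, 0 ≤ p x) (hsum : ∑ x, p x = 1)
    (hacc : 1 - η ≤ ∑ x with wcErr x θ ≤ ξ, p x)
    (hpair : ∀ i j, θ i ≠ θ j → ∑ x with x ∈ correctAt θ j, p x
      ≤ a * ∑ x with x ∈ labelledAt θ i (θ j), p x + b) :
    ((k : ℝ) - 1) * (1 - η - ξ / 2) ≤ a * (η + ξ / 2) + (k - 1) * b := by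
  obtain ⟨hξ0, hξ1⟩ := hξ
  have hmR : (0 : ℝ) < m := by exact_mod_cast hm
  have hkR : (1 : ℝ) ≤ k := by exact_mod_cast hk
  have hmn : m ≤ n := hn ▸ Nat.le_mul_of_pos_left m hk
  have hnR : (n : ℝ) = k * m := by exact_mod_cast hn
  have hnm : ((n - m : ℕ) : ℝ) = (k - 1) * m := by
    rw [Nat.cast_sub hmn, hnR]; ring
  set g : (Fin n → Fin k) → ℝ := fun x => if wcErr x θ ≤ ξ then 1 else 0 with hg
  set X : (Fin n → Fin k) → ℝ :=
    fun x => ((crossPairs θ).filter fun q => x ∈ correctAt θ q.2).card with hX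
  set Y : (Fin n → Fin k) → ℝ :=
    fun x => ((crossPairs θ).filter fun q => x ∈ labelledAt θ q.1 (θ q.2)).card with hY
  have hXb : ∀ x, k * m * ((k - 1) * m) * (1 - ξ / 2) * g x ≤ X x := by
    intro x
    by_cases hx : wcErr x θ ≤ ξ
    · obtain ⟨σ, hσ, herr⟩ := exists_aligned_of_wcErr_le hm hbal hξ1 hx
      have h1 := card_filter_correctAt_ge hbal hσ
      have h2 := Finset.card_filter_add_card_filter_not (s := (Finset.univ : Finset (Fin n)))
        (fun i => σ (x i) = θ i)
      rw [Finset.card_univ, Fintype.card_fin] at h2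
      rw [Fintype.card_fin] at h1
      have h1' := (Nat.cast_le (α := ℝ)).2 h1
      have h2' := congrArg (Nat.cast (R := ℝ)) h2
      push_cast [hnm] at h1' h2'
      have h3 : (0 : ℝ) ≤ (k - 1) * m := mul_nonneg (by linarith) hmR.le
      have h4 : (k : ℝ) * m * (1 - ξ / 2)
          ≤ ((Finset.univ.filter fun i => σ (x i) = θ i).card : ℝ) := by
        simp only [ne_eq] at herr
        rw [hnR] at h2'
        linarith
      simp only [hg, hx, if_true, mul_one, hX]
      refine le_trans ?_ h1'
      calc _ = (k - 1) * m * ((k : ℝ) * m * (1 - ξ / 2)) := by ring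
        _ ≤ _ := mul_le_mul_of_nonneg_left h4 h3
    · simp [hg, hx, hX]
  have hYb : ∀ x, Y x ≤ m * (k * m) * (1 - (1 - ξ / 2) * g x) := by
    intro x
    by_cases hx : wcErr x θ ≤ ξ
    · obtain ⟨σ, hσ, herr⟩ := exists_aligned_of_wcErr_le hm hbal hξ1 hx
      have h1 := (Nat.cast_le (α := ℝ)).2
        (card_filter_labelledAt_le hbal (hσ.mono (by norm_num : 2 ≤ 6)))
      push_cast at h1
      simp only [hg, hx, if_true, mul_one, hY]
      refine h1.trans ?_
      calc _ ≤ (m : ℝ) * (k * m * (ξ / 2)) := mul_le_mul_of_nonneg_left herr hmR.le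
        _ = _ := by ring
    · have h1 := (Nat.cast_le (α := ℝ)).2 (card_filter_labelledAt_le_card (θhat := x) hbal)
      rw [Fintype.card_fin] at h1
      push_cast [hnR] at h1
      simpa [hg, hx, hY] using h1
  have hcross : ((crossPairs θ).card : ℝ) = k * m * ((k - 1) * m) := by
    have h1 := card_cross_filter_snd hbal fun _ => True
    simp only [Finset.filter_true, Finset.card_univ, Fintype.card_fin] at h1
    rw [h1]
    push_cast [hnm, hnR]
    ring
  have hswap : ∀ S : Fin n × Fin n → Set (Fin n → Fin k),
      ∑ q ∈ crossPairs θ, ∑ x with x ∈ S q, p x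
        = ∑ x, p x * (((crossPairs θ).filter fun q => x ∈ S q).card : ℝ) := by
    intro S
    simp only [Finset.sum_filter]
    rw [Finset.sum_comm]
    refine Finset.sum_congr rfl fun x _ => ?_
    rw [← Finset.sum_filter, Finset.sum_const, nsmul_eq_mul, mul_comm]
  have htotal := Finset.sum_le_sum (s := crossPairs θ) fun q hq =>
    hpair q.1 q.2 (Finset.mem_filter.1 hq).2
  rw [Finset.sum_add_distrib, ← Finset.mul_sum, hswap fun q => correctAt θ q.2,
    hswap fun q => labelledAt θ q.1 (θ q.2), Finset.sum_const, nsmul_eq_mul, hcross] at htotal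
  have hpg : 1 - η ≤ ∑ x, p x * g x := by
    simpa [hg, Finset.sum_filter] using hacc
  set G := ∑ x, p x * g x
  have hEX : k * m * ((k - 1) * m) * (1 - ξ / 2) * G ≤ ∑ x, p x * X x := by
    rw [Finset.mul_sum]
    refine Finset.sum_le_sum fun x _ => ?_
    calc _ = p x * (k * m * ((k - 1) * m) * (1 - ξ / 2) * g x) := by ring
      _ ≤ _ := mul_le_mul_of_nonneg_left (hXb x) (hp x)
  have hEY : ∑ x, p x * Y x ≤ m * (k * m) * (1 - (1 - ξ / 2) * G) := by
    calc ∑ x, p x * Y x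
        ≤ ∑ x, p x * (m * (k * m) * (1 - (1 - ξ / 2) * g x)) :=
          Finset.sum_le_sum fun x _ => mul_le_mul_of_nonneg_left (hYb x) (hp x)
      _ = ∑ x, (m * (k * m) * p x - m * (k * m) * (1 - ξ / 2) * (p x * g x)) :=
          Finset.sum_congr rfl fun x _ => by ring
      _ = _ := by
          rw [Finset.sum_sub_distrib, ← Finset.mul_sum, ← Finset.mul_sum, hsum]
          ring
  have hr : 1 - η - ξ / 2 ≤ (1 - ξ / 2) * G := by nlinarith
  have hM : (0 : ℝ) < k * m * m := by positivity
  refine le_of_mul_le_mul_left ?_ hM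
  calc k * m * m * ((k - 1) * (1 - η - ξ / 2))
      = k * m * m * (k - 1) * (1 - η - ξ / 2) := by ring
    _ ≤ k * m * m * (k - 1) * ((1 - ξ / 2) * G) :=
        mul_le_mul_of_nonneg_left hr (mul_nonneg hM.le (by linarith))
    _ = k * m * ((k - 1) * m) * (1 - ξ / 2) * G := by ring
    _ ≤ a * ∑ x, p x * Y x + k * m * ((k - 1) * m) * b := hEX.trans htotal
    _ ≤ a * (m * (k * m) * (1 - (1 - ξ / 2) * G)) + k * m * ((k - 1) * m) * b := by
        gcongr
    _ ≤ a * (m * (k * m) * (η + ξ / 2)) + k * m * ((k - 1) * m) * b := by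
        gcongr
        linarith
    _ = k * m * m * (a * (η + ξ / 2) + (k - 1) * b) := by ring

end Averaging

lemma permMat_conj {n : ℕ} (σ : Equiv.Perm (Fin n)) (A : Matrix (Fin n) (Fin n) ℝ) :
    permMat σ * A * (permMat σ)ᵀ = A.submatrix σ.symm σ.symm := by
  ext a b
  simp only [Matrix.mul_apply, permMat, Matrix.transpose_apply, Matrix.of_apply,
    Matrix.submatrix_apply, ← Equiv.eq_symm_apply, ite_mul, one_mul, zero_mul, mul_ite, mul_one,
    mul_zero, Finset.sum_ite_eq', Finset.mem_univ, if_true]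

lemma IsNodeDP.swap_le {n k : ℕ} {M : Matrix (Fin n) (Fin n) ℝ → PMF (Fin n → Fin k)}
    {ε δ : ℝ} (hDP : IsNodeDP M ε δ) {A : Matrix (Fin n) (Fin n) ℝ} (hA : Is01 A)
    (i j : Fin n) (S : Set (Fin n → Fin k)) :
    (M A).toOuterMeasure S ≤ ENNReal.ofReal (Real.exp ε) * (ENNReal.ofReal (Real.exp ε) *
      (M (A.submatrix (Equiv.swap i j) (Equiv.swap i j))).toOuterMeasure S + ENNReal.ofReal δ)
      + ENNReal.ofReal δ := by
  set A₂ := A.submatrix (Equiv.swap i j) (Equiv.swap i j) with hA₂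
  have h₂ : Is01 A₂ := fun a b => hA _ _
  set A₁ : Matrix (Fin n) (Fin n) ℝ :=
    Matrix.of fun a b => if a = i ∨ b = i then A₂ a b else A a b with hA₁
  have h₁ : Is01 A₁ := by
    intro a b
    simp only [hA₁, Matrix.of_apply]
    split_ifs
    exacts [h₂ a b, hA a b]
  have adj : NodeAdj A A₁ := ⟨i, fun a b ha hb => by simp [hA₁, ha, hb]⟩
  have adj' : NodeAdj A₁ A₂ := by
    refine ⟨j, fun a b ha hb => ?_⟩
    simp only [hA₁, Matrix.of_apply]
    split_ifs with h
    · rfl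
    · push Not at h
      simp [hA₂, Equiv.swap_apply_of_ne_of_ne, h.1, h.2, ha, hb]
  refine (hDP A A₁ hA h₁ adj S).trans ?_
  gcongr
  exact hDP A₁ A₂ h₁ h₂ adj' S

lemma IsSymmetricMech.toOuterMeasure_swap {n k : ℕ}
    {M : Matrix (Fin n) (Fin n) ℝ → PMF (Fin n → Fin k)} (hsym : IsSymmetricMech M)
    {A : Matrix (Fin n) (Fin n) ℝ} (hA : Is01 A) (i j : Fin n) (S : Set (Fin n → Fin k)) :
    (M (A.submatrix (Equiv.swap i j) (Equiv.swap i j))).toOuterMeasure S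
      = (M A).toOuterMeasure {x | (fun v => x (Equiv.swap i j v)) ∈ S} := by
  classical
  rw [PMF.toOuterMeasure_apply_fintype, PMF.toOuterMeasure_apply_fintype,
    ← Equiv.sum_comp ((Equiv.swap i j).arrowCongr (Equiv.refl (Fin k)))]
  refine Finset.sum_congr rfl fun x _ => ?_
  have h := hsym (Equiv.swap i j) A x hA
  rw [permMat_conj, Equiv.symm_swap, Equiv.swap_inv] at h
  have hx : (Equiv.swap i j).arrowCongr (Equiv.refl (Fin k)) x
      = fun v => x (Equiv.swap i j v) := by
    ext v
    simp
  simp only [Set.indicator_apply, hx, h, Set.mem_ofPred_eq]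

lemma isProbabilityMeasure_bern {p : ℝ} (hp : p ∈ Set.Icc (0 : ℝ) 1) :
    IsProbabilityMeasure (bern p) := by
  constructor
  simp only [bern, Measure.coe_add, Pi.add_apply, Measure.smul_apply, smul_eq_mul,
    measure_univ, mul_one]
  rw [← ENNReal.ofReal_add (by linarith [hp.2]) hp.1]
  simp

lemma ae_bern (p : ℝ) : ∀ᵐ x ∂bern p, x = 0 ∨ x = 1 := by
  rw [bern, ae_add_measure_iff]
  refine ⟨Measure.ae_smul_measure ?_ _, Measure.ae_smul_measure ?_ _⟩ <;>
    simp [ae_dirac_eq]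

lemma measurable_sbm_matrix (n : ℕ) :
    Measurable fun (x : {q : Fin n × Fin n // q.1 < q.2} → ℝ) =>
      (Matrix.of fun i j => if h : i < j then x ⟨(i, j), h⟩ else
        if h' : j < i then x ⟨(j, i), h'⟩ else 0 : Matrix (Fin n) (Fin n) ℝ) := by
  refine measurable_pi_lambda _ fun i => measurable_pi_lambda _ fun j => ?_
  simp only [Matrix.of_apply]
  split_ifs
  exacts [measurable_pi_apply _, measurable_pi_apply _, measurable_const]

lemma isProbabilityMeasure_sbm {n k : ℕ} {B : Matrix (Fin k) (Fin k) ℝ}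
    (hB : ∀ a b, B a b ∈ Set.Icc (0 : ℝ) 1) (θ : Fin n → Fin k) :
    IsProbabilityMeasure (sbm n k B θ) := by
  have (p : {q : Fin n × Fin n // q.1 < q.2}) :
      IsProbabilityMeasure (bern (B (θ p.1.1) (θ p.1.2))) := isProbabilityMeasure_bern (hB _ _)
  exact Measure.isProbabilityMeasure_map (measurable_sbm_matrix n).aemeasurable

lemma ae_is01_sbm {n k : ℕ} (B : Matrix (Fin k) (Fin k) ℝ) (θ : Fin n → Fin k) :
    ∀ᵐ A ∂sbm n k B θ, Is01 A := by
  have hmeas : MeasurableSet {A : Matrix (Fin n) (Fin n) ℝ | Is01 A} := by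
    simp only [Is01, Set.ofPred_forall]
    refine MeasurableSet.iInter fun i => MeasurableSet.iInter fun j => ?_
    have hij : Measurable fun A : Matrix (Fin n) (Fin n) ℝ => A i j :=
      (measurable_pi_apply j).comp (measurable_pi_apply i)
    exact hij (measurableSet_insert.2 (measurableSet_singleton 1) : MeasurableSet {(0 : ℝ), 1})
  rw [sbm, ae_map_iff (measurable_sbm_matrix n).aemeasurable hmeas]
  have h : ∀ᵐ x ∂(Measure.pi fun p : {q : Fin n × Fin n // q.1 < q.2} =>
      bern (B (θ p.1.1) (θ p.1.2))), ∀ p, x p = 0 ∨ x p = 1 :=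
    ae_all_iff.2 fun p => Measure.tendsto_eval_ae_ae.eventually
      (p := fun y => y = 0 ∨ y = 1) (ae_bern _)
  filter_upwards [h] with x hx i j
  simp only [Matrix.of_apply]
  split_ifs
  exacts [hx _, hx _, Or.inl rfl]

lemma PMF.toReal_toOuterMeasure {α : Type*} [Fintype α] (P : PMF α) (S : Set α)
    [DecidablePred (· ∈ S)] :
    (P.toOuterMeasure S).toReal = ∑ x with x ∈ S, (P x).toReal := by
  rw [PMF.toOuterMeasure_apply_fintype, ENNReal.toReal_sum, Finset.sum_filter]
  · refine Finset.sum_congr rfl fun x _ => ?_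
    by_cases hx : x ∈ S <;> simp [hx]
  · intro x _
    by_cases hx : x ∈ S <;> simp [hx, P.apply_ne_top]

lemma PMF.toOuterMeasure_apply_le_one {α : Type*} (P : PMF α) (S : Set α) :
    P.toOuterMeasure S ≤ 1 := by
  rw [PMF.toOuterMeasure_apply, ← P.tsum_coe]
  exact ENNReal.tsum_le_tsum fun x => Set.indicator_le_self' (fun _ _ => zero_le) x

lemma PMF.toOuterMeasure_ne_top {α : Type*} (P : PMF α) (S : Set α) :
    P.toOuterMeasure S ≠ ⊤ :=
  ne_top_of_le_ne_top ENNReal.one_ne_top (P.toOuterMeasure_apply_le_one S)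

/-- For `k ≥ 2` dividing `n` with `n/k ≥ 6`, balanced `θ`, a symmetric
`(ε,δ)`-node DP mechanism `M`, and `A ~ SBM(n,k,B,θ)` independent of the mechanism's
internal randomness: if `P(𝓛̃(M(A), θ) ≤ ξ) ≥ 1 − η` with `ξ ∈ (0,1/3)` and the stated
positivity conditions hold, then
`ε ≥ (1/2)·log((1−η−ξ−2kδ)/(η+ξ+2kδ)) + (1/2)·log(k−1)`. -/
theorem eps_lower_bound_SBM {n k : ℕ} (hk : 2 ≤ k) (hkn : k ∣ n) (hsize : 6 ≤ n / k)
    (θ : Fin n → Fin k)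
    (hbal : ∀ j : Fin k, (Finset.univ.filter fun i => θ i = j).card = n / k)
    (B : Matrix (Fin k) (Fin k) ℝ) (hBsymm : B.IsSymm)
    (hB : ∀ a b, B a b ∈ Set.Ioc (0 : ℝ) 1)
    (ε δ : ℝ) (hε : 0 ≤ ε) (hδ : 0 ≤ δ)
    (M : Matrix (Fin n) (Fin n) ℝ → PMF (Fin n → Fin k))
    (hDP : IsNodeDP M ε δ) (hsym : IsSymmetricMech M)
    (ξ η : ℝ) (hξ : ξ ∈ Set.Ioo (0 : ℝ) (1 / 3)) (hη : 0 ≤ η)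
    (hpos : 0 < η + ξ + 2 * k * δ)
    (hlt : 0 < 1 - η - ξ - 2 * k * δ)
    (hacc : ENNReal.ofReal (1 - η)
      ≤ ∫⁻ A, (M A).toOuterMeasure {θhat | wcErr θhat θ ≤ ξ} ∂(sbm n k B θ)) :
    (1 / 2) * Real.log ((1 - η - ξ - 2 * k * δ) / (η + ξ + 2 * k * δ))
        + (1 / 2) * Real.log ((k : ℝ) - 1) ≤ ε := by
  classical
  obtain ⟨m, hm⟩ : ∃ m, m = n / k := ⟨_, rfl⟩
  rw [← hm] at hsize
  simp only [← hm] at hbal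
  have hn : n = k * m := by rw [hm, Nat.mul_div_cancel' hkn]
  have := isProbabilityMeasure_sbm (fun a b => ⟨(hB a b).1.le, (hB a b).2⟩) θ
  obtain ⟨A, hA, hAcc⟩ : ∃ A, Is01 A ∧
      ENNReal.ofReal (1 - η) ≤ (M A).toOuterMeasure {x | wcErr x θ ≤ ξ} := by
    have hfin : ∫⁻ A, (M A).toOuterMeasure {x | wcErr x θ ≤ ξ} ∂(sbm n k B θ) ≠ ⊤ := by
      refine ne_top_of_le_ne_top ENNReal.one_ne_top ?_
      calc _ ≤ ∫⁻ _, 1 ∂(sbm n k B θ) :=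
            lintegral_mono fun A => (M A).toOuterMeasure_apply_le_one _
        _ = 1 := by simp
    obtain ⟨A, hA, hle⟩ := exists_notMem_null_lintegral_le hfin (ae_is01_sbm B θ)
    exact ⟨A, not_not.1 hA, hacc.trans hle⟩
  have hkR : (2 : ℝ) ≤ k := by exact_mod_cast hk
  have he : 1 ≤ Real.exp ε := Real.one_le_exp hε
  have hpair : ∀ i j, ∑ x with x ∈ correctAt θ j, ((M A) x).toReal
      ≤ Real.exp ε * Real.exp ε * ∑ x with x ∈ labelledAt θ i (θ j), ((M A) x).toReal
        + (Real.exp ε * δ + δ) := by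
    intro i j
    have h := hDP.swap_le hA i j (correctAt θ j)
    rw [hsym.toOuterMeasure_swap hA] at h
    have hsub : {x : Fin n → Fin k | (fun v => x (Equiv.swap i j v)) ∈ correctAt θ j}
        ⊆ labelledAt θ i (θ j) := by
      rintro x ⟨σ, hσ, hl⟩
      beta_reduce at hl
      rw [Equiv.swap_apply_right] at hl
      exact ⟨σ, hσ.of_comp_swap i j fun c => (hbal c).symm ▸ hsize, hl⟩
    replace h := h.trans (b := _) (c := ENNReal.ofReal (Real.exp ε) *
      (ENNReal.ofReal (Real.exp ε) * (M A).toOuterMeasure (labelledAt θ i (θ j))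
        + ENNReal.ofReal δ) + ENNReal.ofReal δ) (by gcongr)
    have hfin := (M A).toOuterMeasure_ne_top (labelledAt θ i (θ j))
    have h' := ENNReal.toReal_mono (by finiteness) h
    rw [ENNReal.toReal_add (by finiteness) (by finiteness), ENNReal.toReal_mul,
      ENNReal.toReal_add (by finiteness) (by finiteness), ENNReal.toReal_mul,
      ENNReal.toReal_ofReal (by positivity), ENNReal.toReal_ofReal hδ,
      PMF.toReal_toOuterMeasure, PMF.toReal_toOuterMeasure] at h'
    linarith
  have hsum : ∑ x, ((M A) x).toReal = 1 := by
    rw [← ENNReal.toReal_sum fun x _ => (M A).apply_ne_top x, ← tsum_fintype (L := .unconditional _), PMF.tsum_coe,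
      ENNReal.toReal_one]
  have hacc' : 1 - η ≤ ∑ x with wcErr x θ ≤ ξ, ((M A) x).toReal := by
    have h := (ENNReal.ofReal_le_iff_le_toReal ((M A).toOuterMeasure_ne_top _)).1 hAcc
    rw [PMF.toReal_toOuterMeasure] at h
    simpa using h
  have main := averaged_inequality (by omega) (by omega) hn hbal hξ hη
    (by positivity : (0 : ℝ) ≤ Real.exp ε * Real.exp ε) _ (fun _ => ENNReal.toReal_nonneg)
    hsum (by convert hacc') (fun i j _ => by convert hpair i j)
  have hξ0 := hξ.1
  have key : ((k : ℝ) - 1) * (1 - η - ξ - 2 * k * δ)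
      ≤ Real.exp (2 * ε) * (η + ξ + 2 * k * δ) := by
    rw [two_mul ε, Real.exp_add]
    have h1 : ((k : ℝ) - 1) * (Real.exp ε * δ) ≤ Real.exp ε * Real.exp ε * (2 * k * δ) := by
      have : Real.exp ε ≤ Real.exp ε * Real.exp ε := le_mul_of_one_le_left (by positivity) he
      calc _ = Real.exp ε * ((k - 1) * δ) := by ring
        _ ≤ Real.exp ε * Real.exp ε * (2 * k * δ) := by
            refine mul_le_mul this ?_ (mul_nonneg (by linarith) hδ) (by positivity)
            gcongr
            linarith
    have h2 : ((k : ℝ) - 1) * δ ≤ (k - 1) * (2 * k * δ) :=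
      mul_le_mul_of_nonneg_left (by nlinarith) (by linarith)
    have h3 : 0 ≤ Real.exp ε * Real.exp ε * (ξ / 2) := by positivity
    have h4 : 0 ≤ ((k : ℝ) - 1) * (ξ / 2) := mul_nonneg (by linarith) (by linarith)
    linarith
  have hlog := Real.log_le_log (mul_pos (div_pos hlt hpos) (by linarith) : 0 < ((1 - η - ξ - 2 * k * δ) /
      (η + ξ + 2 * k * δ)) * ((k : ℝ) - 1)) (y := Real.exp (2 * ε)) (by
    rw [div_mul_eq_mul_div, div_le_iff₀ hpos]
    linarith)
  rw [Real.log_exp, Real.log_mul (div_pos hlt hpos).ne' (by linarith)] at hlog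
  linarith
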